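/- Let τ₁, τ₂ ∈ W_n with τ₁ ≤ τ₂ ≤ ω with respect to the partial order coming from (W_n, R_n), where ω = (1,2,...,n,-1,-2,...,-n). Then τ₁ ≤ τ₂ with respect to the partial order coming from (S_{±n}, T_{±n}), i.e., the order defined by word-length with respect to all transpositions of the symmetric group on [±n]. -/

import Mathlib

open scoped Classical

namespace NCPB

/-- A collection of subsets of `α` is a partition: blocks are nonempty and
every element lies in exactly one block. -/
def IsPartition {α : Type*} (P : Set (Set α)) : Prop :=
  (∀ B ∈ P, B.Nonempty) ∧ ∀ a : α, ∃! B, B ∈ P ∧ a ∈ B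

/-- The non-crossing condition for a collection of subsets of a linear order:
if `a < b < c < d`, `a, c` lie in a block `B` and `b, d` lie in a block `C`,
then `b ∈ B` (i.e. the blocks coincide). -/
def IsNC {α : Type*} [LinearOrder α] (P : Set (Set α)) : Prop :=
  ∀ B ∈ P, ∀ C ∈ P, ∀ a b c d : α, a < b → b < c → c < d →
    a ∈ B → c ∈ B → b ∈ C → d ∈ C → b ∈ B

/-- A non-crossing partition of a linear order. -/
def NCPart {α : Type*} [LinearOrder α] (P : Set (Set α)) : Prop :=
  IsPartition P ∧ IsNC P

/-- The set `[±m] = {1 < 2 < ... < m < -1 < -2 < ... < -m}` is encoded as `Fin (2*m)`,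
position `k < m` encoding `k+1` and position `m + j` encoding `-(j+1)`.
`negMap` is the inversion map `a ↦ -a`. -/
def negMap (m : ℕ) (k : Fin (2*m)) : Fin (2*m) :=
  ⟨(k.val + m) % (2*m), Nat.mod_lt _ (Nat.lt_of_le_of_lt (Nat.zero_le _) k.isLt)⟩

/-- Image of a subset of `[±m]` under the inversion map, i.e. `X ↦ -X`. -/
def negSet (m : ℕ) (X : Set (Fin (2*m))) : Set (Fin (2*m)) := negMap m '' X

/-- The absolute value map `[±m] → {1,...,m}`, `±i ↦ i`. -/
def absMap (m : ℕ) (k : Fin (2*m)) : Fin m :=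
  ⟨k.val % m, Nat.mod_lt _ (by have := k.isLt; omega)⟩

/-- A non-crossing partition of type B: a non-crossing partition of `[±m]`
invariant under the inversion map. -/
def NCBPart (m : ℕ) (π : Set (Set (Fin (2*m)))) : Prop :=
  NCPart π ∧ ∀ B ∈ π, negSet m B ∈ π

/-- The collection of sets `Abs(X)`, `X` a block of `π`. -/
def absPart (m : ℕ) (π : Set (Set (Fin (2*m)))) : Set (Set (Fin m)) :=
  {F | ∃ X ∈ π, F = absMap m '' X}

/-- The embedding of `{1,...,m}` onto the odd-indexed positions of the interleaved
set `1 < 1̄ < 2 < 2̄ < ... < m < m̄` (encoded as `Fin (2*m)`): `i ↦ i` (even positions). -/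
def evens (m : ℕ) (i : Fin m) : Fin (2*m) := ⟨2*i.val, by have := i.isLt; omega⟩

/-- The embedding of the barred copy `{1̄,...,m̄}` into the interleaved set: odd positions. -/
def odds (m : ℕ) (i : Fin m) : Fin (2*m) := ⟨2*i.val+1, by have := i.isLt; omega⟩

/-- `P` refines... rather: every block of `P` is contained in a block of `Q`
(the partial order on partitions by reverse refinement: `P ≤ Q`). -/
def Refines {α : Type*} (P Q : Set (Set α)) : Prop := ∀ B ∈ P, ∃ C ∈ Q, B ⊆ C

/-- The collection `p ∪ q̄` of subsets of the interleaved set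
`1 < 1̄ < 2 < 2̄ < ... < m < m̄`, with `p` living on the unbarred copy and `q` on the
barred copy. -/
def interleave (m : ℕ) (p q : Set (Set (Fin m))) : Set (Set (Fin (2*m))) :=
  ((fun B => evens m '' B) '' p) ∪ ((fun B => odds m '' B) '' q)

/-- `q` is the Kreweras complement of `p`: `q` is the largest non-crossing partition
(in the reverse-refinement order) such that `p ∪ q̄` is a non-crossing partition of the
interleaved set `1 < 1̄ < ... < m < m̄`. -/
def IsKr (m : ℕ) (p q : Set (Set (Fin m))) : Prop :=
  NCPart q ∧ NCPart (interleave m p q) ∧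
  ∀ q', NCPart q' → NCPart (interleave m p q') → Refines q' q

/-- Two sets cross: there are `a < b < c < d` with `a, c ∈ B` and `b, d ∈ C`. -/
def Crossing {α : Type*} [LinearOrder α] (B C : Set α) : Prop :=
  ∃ a b c d : α, a < b ∧ b < c ∧ c < d ∧ a ∈ B ∧ c ∈ B ∧ b ∈ C ∧ d ∈ C

/-- Two members of a non-crossing family of pairwise disjoint sets: disjoint,
and neither crosses the other. -/
def PairNC {α : Type*} [LinearOrder α] (B C : Set α) : Prop :=
  Disjoint B C ∧ ¬ Crossing B C ∧ ¬ Crossing C B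

end NCPB
namespace NCPB

/-- The generating set `R_n` of the hyperoctahedral group: all transpositions `(i,-i)`
and all products `(i,j)(-i,-j)` with `|i| ≠ |j|`. -/
def Rn (n : ℕ) : Set (Equiv.Perm (Fin (2*n))) :=
  {ρ | (∃ i, ρ = Equiv.swap i (negMap n i)) ∨
       (∃ i j, absMap n i ≠ absMap n j ∧
          ρ = Equiv.swap i j * Equiv.swap (negMap n i) (negMap n j))}

/-- Membership in the hyperoctahedral group `W_n`: permutations of `[±n]` commuting
with the inversion map. -/
def InWn (n : ℕ) (τ : Equiv.Perm (Fin (2*n))) : Prop :=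
  ∀ k, τ (negMap n k) = negMap n (τ k)

/-- Word-length with respect to the generating set `R_n`. -/
noncomputable def lenB (n : ℕ) (τ : Equiv.Perm (Fin (2*n))) : ℕ :=
  sInf {k | ∃ l : List (Equiv.Perm (Fin (2*n))),
    (∀ ρ ∈ l, ρ ∈ Rn n) ∧ l.length = k ∧ l.prod = τ}

/-- The partial order on `W_n` coming from `(W_n, R_n)`: `a ≤ b` iff `|a| + |a⁻¹b| = |b|`. -/
def leB (n : ℕ) (a b : Equiv.Perm (Fin (2*n))) : Prop :=
  lenB n a + lenB n (a⁻¹ * b) = lenB n b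

/-- `b` covers `a` in the partial order coming from `(W_n, R_n)`. -/
def CoversB (n : ℕ) (a b : Equiv.Perm (Fin (2*n))) : Prop :=
  leB n a b ∧ lenB n b = lenB n a + 1

/-- The orbits of a permutation. -/
def orbitsOf (n : ℕ) (τ : Equiv.Perm (Fin (2*n))) : Set (Set (Fin (2*n))) :=
  {O | ∃ x, O = {y | τ.SameCycle x y}}

/-- Word-length with respect to the set of all transpositions of a symmetric group. -/
noncomputable def lenA (N : ℕ) (τ : Equiv.Perm (Fin N)) : ℕ :=
  sInf {k | ∃ l : List (Equiv.Perm (Fin N)),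
    (∀ ρ ∈ l, ρ.IsSwap) ∧ l.length = k ∧ l.prod = τ}

/-- The partial order on the symmetric group coming from all transpositions. -/
def leA (N : ℕ) (a b : Equiv.Perm (Fin N)) : Prop :=
  lenA N a + lenA N (a⁻¹ * b) = lenA N b

/-- `τ = ι(π)`: for each block `B` of `π` and `a ∈ B`, `τ a` is the cyclic successor of
`a` in `B` (the least element of `B` greater than `a`, or the least element of `B` if
`a` is the largest element of `B`). -/
def IsIota (N : ℕ) (π : Set (Set (Fin N))) (τ : Equiv.Perm (Fin N)) : Prop :=
  ∀ B ∈ π, ∀ a ∈ B,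
    ((∃ b ∈ B, a < b) → IsLeast {b | b ∈ B ∧ a < b} (τ a)) ∧
    ((∀ b ∈ B, ¬ a < b) → IsLeast B (τ a))

/-- The long inversion-invariant cycle `ω = (1, 2, ..., n, -1, -2, ..., -n)`. -/
def omegaW (n : ℕ) : Equiv.Perm (Fin (2*n)) := finRotate (2*n)

end NCPB

namespace NCPB

section SymmetricGroup

variable {N : ℕ}

lemma lenA_le_length {l : List (Equiv.Perm (Fin N))} (hl : ∀ ρ ∈ l, ρ.IsSwap) :
    lenA N l.prod ≤ l.length :=
  Nat.sInf_le ⟨l, hl, rfl, rfl⟩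

lemma exists_swap_word (τ : Equiv.Perm (Fin N)) :
    ∃ l : List (Equiv.Perm (Fin N)),
      (∀ ρ ∈ l, ρ.IsSwap) ∧ l.length = lenA N τ ∧ l.prod = τ := by
  have hne : {k | ∃ l : List (Equiv.Perm (Fin N)),
      (∀ ρ ∈ l, ρ.IsSwap) ∧ l.length = k ∧ l.prod = τ}.Nonempty := by
    obtain ⟨l, hprod, hl⟩ := Equiv.Perm.swapFactors τ
    exact ⟨l.length, l, hl, rfl, hprod⟩
  exact Nat.sInf_mem hne

lemma lenA_mul_le (σ τ : Equiv.Perm (Fin N)) : lenA N (σ * τ) ≤ lenA N σ + lenA N τ := by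
  obtain ⟨l, hl, hlen, rfl⟩ := exists_swap_word σ
  obtain ⟨l', hl', hlen', rfl⟩ := exists_swap_word τ
  rw [← hlen, ← hlen', ← List.prod_append, ← List.length_append]
  refine lenA_le_length fun ρ hρ => ?_
  rcases List.mem_append.1 hρ with h | h
  exacts [hl ρ h, hl' ρ h]

lemma lenA_swap_le_one (i j : Fin N) : lenA N (Equiv.swap i j) ≤ 1 := by
  rcases eq_or_ne i j with rfl | hij
  · rw [Equiv.swap_self]
    exact (lenA_le_length (l := []) (by simp)).trans (by simp)
  · simpa using lenA_le_length (l := [Equiv.swap i j]) (by simpa using ⟨i, j, hij, rfl⟩)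

lemma sign_eq_neg_one_pow_lenA (τ : Equiv.Perm (Fin N)) :
    Equiv.Perm.sign τ = (-1) ^ lenA N τ := by
  obtain ⟨l, hl, hlen, hprod⟩ := exists_swap_word τ
  rw [← hlen, ← hprod, Equiv.Perm.sign_prod_list_swap hl]

lemma even_lenA_mul_iff (σ τ : Equiv.Perm (Fin N)) :
    Even (lenA N (σ * τ)) ↔ Even (lenA N σ + lenA N τ) := by
  have h := Equiv.Perm.sign_mul σ τ
  simp only [sign_eq_neg_one_pow_lenA, ← pow_add] at h
  have h1 (k : ℕ) : (-1 : ℤˣ) ^ k = 1 ↔ Even k := neg_one_pow_eq_one_iff_even (by decide)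
  rw [← h1, ← h1, h]

/-- The graph whose edges are the pairs exchanged by the transpositions in a word. -/
def swapGraph (l : List (Equiv.Perm (Fin N))) : SimpleGraph (Fin N) :=
  SimpleGraph.fromRel fun i j => Equiv.swap i j ∈ l

lemma swapGraph_reachable_apply {l : List (Equiv.Perm (Fin N))}
    {ρ : Equiv.Perm (Fin N)} (hρ : ρ ∈ l) (hswap : ρ.IsSwap) (x : Fin N) :
    (swapGraph l).Reachable x (ρ x) := by
  obtain ⟨i, j, hij, rfl⟩ := hswap
  have hadj : (swapGraph l).Adj i j := by
    simpa [swapGraph] using ⟨hij, Or.inl hρ⟩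
  rw [Equiv.swap_apply_def]
  split_ifs with h h
  · exact h ▸ hadj.reachable
  · exact h ▸ hadj.symm.reachable
  · exact .refl _

lemma swapGraph_reachable_prod {l : List (Equiv.Perm (Fin N))} (hl : ∀ ρ ∈ l, ρ.IsSwap)
    (x : Fin N) : (swapGraph l).Reachable x (l.prod x) := by
  suffices H : ∀ l' : List (Equiv.Perm (Fin N)), (∀ ρ ∈ l', ρ ∈ l) →
      (swapGraph l).Reachable x (l'.prod x) from H l fun _ h => h
  intro l' hl'
  induction l' with
  | nil => simp
  | cons ρ t ih =>
    rw [List.prod_cons, Equiv.Perm.mul_apply]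
    have hρ := hl' ρ (by simp)
    exact (ih fun σ hσ => hl' σ (by simp [hσ])).trans
      (swapGraph_reachable_apply hρ (hl ρ hρ) _)

lemma card_edgeSet_swapGraph_le (l : List (Equiv.Perm (Fin N))) :
    Nat.card (swapGraph l).edgeSet ≤ l.length := by
  let f : Sym2 (Fin N) → Equiv.Perm (Fin N) :=
    Sym2.lift ⟨fun i j => Equiv.swap i j, Equiv.swap_comm⟩
  have hmaps : ∀ e ∈ (swapGraph l).edgeSet, f e ∈ (l.toFinset : Set (Equiv.Perm (Fin N))) := by
    intro e
    induction e with
    | h i j =>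
      intro h
      simp only [swapGraph, SimpleGraph.mem_edgeSet, SimpleGraph.fromRel_adj] at h
      rcases h.2 with h' | h'
      · simpa [f] using h'
      · simpa [f, Equiv.swap_comm] using h'
  have hinj : Set.InjOn f (swapGraph l).edgeSet := by
    intro e he e' he' hee
    induction e with
    | h i j =>
    induction e' with
    | h a b =>
      have hij : i ≠ j := (SimpleGraph.mem_edgeSet _ |>.1 he).ne
      have hfe : Equiv.swap i j = Equiv.swap a b := hee
      have h1 := congrArg (· i) hfe
      have h2 := congrArg (· j) hfe
      simp only [Equiv.swap_apply_left, Equiv.swap_apply_right, Equiv.swap_apply_def] at h1 h2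
      rw [Sym2.eq_iff]
      grind
  have h := Set.ncard_le_ncard_of_injOn f hmaps hinj (Finset.finite_toSet _)
  rw [Set.ncard_coe_finset] at h
  exact h.trans l.toFinset_card_le

lemma le_lenA_add_one [NeZero N] {τ : Equiv.Perm (Fin N)}
    (hτ : ∀ x y, τ.SameCycle x y) : N ≤ lenA N τ + 1 := by
  obtain ⟨l, hl, hlen, rfl⟩ := exists_swap_word τ
  have hnat (k : ℕ) (x : Fin N) : (swapGraph l).Reachable x ((l.prod ^ k) x) := by
    induction k with
    | zero => simp
    | succ k ih =>
      rw [pow_succ', Equiv.Perm.mul_apply]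
      exact ih.trans (swapGraph_reachable_prod hl _)
  have hconn : (swapGraph l).Connected := by
    rw [SimpleGraph.connected_iff]
    refine ⟨fun x y => ?_, inferInstance⟩
    obtain ⟨k, rfl⟩ := (hτ x y).exists_nat_pow_eq
    exact hnat k x
  have h := hconn.card_vert_le_card_edgeSet_add_one
  rw [Nat.card_fin] at h
  have := card_edgeSet_swapGraph_le l
  omega

lemma sameCycle_finRotate (hN : 2 ≤ N) (x y : Fin N) : (finRotate N).SameCycle x y := by
  have hsupp (z : Fin N) : finRotate N z ≠ z := by
    rw [← Equiv.Perm.mem_support, support_finRotate_of_le hN]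
    exact Finset.mem_univ z
  exact (isCycle_finRotate_of_le hN).sameCycle (hsupp x) (hsupp y)

end SymmetricGroup

section Hyperoctahedral

variable {n : ℕ}

lemma negMap_negMap (k : Fin (2 * n)) : negMap n (negMap n k) = k := by
  apply Fin.ext
  have := k.isLt
  simp only [negMap, Nat.mod_add_mod]
  rw [show k.val + n + n = k.val + 2 * n by ring, Nat.add_mod_right, Nat.mod_eq_of_lt this]

lemma negMap_injective : Function.Injective (negMap n) :=
  Function.LeftInverse.injective negMap_negMap

lemma val_negMap (k : Fin (2 * n)) :
    (negMap n k).val = if k.val < n then k.val + n else k.val - n := by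
  have := k.isLt
  simp only [negMap]
  split_ifs with h
  · exact Nat.mod_eq_of_lt (by omega)
  · rw [Nat.mod_eq_sub_mod (by omega), Nat.mod_eq_of_lt (by omega)]
    omega

lemma negMap_ne (k : Fin (2 * n)) : negMap n k ≠ k := by
  intro h
  have := congrArg Fin.val h
  rw [val_negMap] at this
  have := k.isLt
  split_ifs at * <;> omega

lemma absMap_eq_iff {i j : Fin (2 * n)} :
    absMap n i = absMap n j ↔ j = i ∨ j = negMap n i := by
  have hval (k : Fin (2 * n)) :
      (absMap n k).val = if k.val < n then k.val else k.val - n := by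
    have := k.isLt
    simp only [absMap]
    split_ifs with h
    · exact Nat.mod_eq_of_lt h
    · rw [Nat.mod_eq_sub_mod (by omega), Nat.mod_eq_of_lt (by omega)]
  have := i.isLt
  have := j.isLt
  rw [Fin.ext_iff, Fin.ext_iff, Fin.ext_iff, hval, hval, val_negMap]
  split_ifs <;> omega

lemma InWn.mul {σ τ : Equiv.Perm (Fin (2 * n))} (hσ : InWn n σ) (hτ : InWn n τ) :
    InWn n (σ * τ) := fun k => by
  rw [Equiv.Perm.mul_apply, Equiv.Perm.mul_apply, hτ, hσ]

lemma InWn.inv {τ : Equiv.Perm (Fin (2 * n))} (hτ : InWn n τ) : InWn n τ⁻¹ := fun k => by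
  rw [Equiv.Perm.inv_eq_iff_eq, hτ, ← Equiv.Perm.mul_apply, mul_inv_cancel, Equiv.Perm.one_apply]

lemma inWn_omegaW : InWn n (omegaW n) := fun k => by
  have := k.neZero
  have hneg (x : Fin (2 * n)) : negMap n x = x + ⟨n, by have := k.isLt; omega⟩ := by
    apply Fin.ext
    simp [negMap, Fin.val_add]
  rw [omegaW, finRotate_apply, finRotate_apply, hneg, hneg, add_right_comm]

lemma inWn_of_mem_Rn {ρ : Equiv.Perm (Fin (2 * n))} (hρ : ρ ∈ Rn n) : InWn n ρ := by
  intro k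
  rcases hρ with ⟨i, rfl⟩ | ⟨i, j, hij, rfl⟩
  · rw [← negMap_injective.swap_apply, negMap_negMap, Equiv.swap_comm]
  · rw [Equiv.Perm.mul_apply, Equiv.Perm.mul_apply, ← negMap_injective.swap_apply,
      ← negMap_injective.swap_apply, negMap_negMap, negMap_negMap]
    have hne := mt absMap_eq_iff.2 hij
    have := negMap_ne i
    have := negMap_ne j
    have := negMap_negMap i
    have := negMap_negMap j
    simp only [Equiv.swap_apply_def]
    grind

lemma mul_self_of_mem_Rn {ρ : Equiv.Perm (Fin (2 * n))} (hρ : ρ ∈ Rn n) : ρ * ρ = 1 := by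
  rcases hρ with ⟨i, rfl⟩ | ⟨i, j, hij, rfl⟩
  · exact Equiv.swap_mul_self _ _
  · ext k : 1
    have hne := mt absMap_eq_iff.2 hij
    have := negMap_ne i
    have := negMap_ne j
    have := negMap_negMap i
    have := negMap_negMap j
    simp only [Equiv.Perm.mul_apply, Equiv.swap_apply_def, Equiv.Perm.one_apply]
    grind

/-- A signed permutation moving `i` to `j` can be corrected at `±i` by one generator which
fixes every fixed point. -/
lemma exists_mem_Rn_apply_eq {τ : Equiv.Perm (Fin (2 * n))} (hτ : InWn n τ)
    {i : Fin (2 * n)} (hi : τ i ≠ i) :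
    ∃ ρ ∈ Rn n, ρ (τ i) = i ∧ ∀ k, τ k = k → ρ k = k := by
  have hneg : τ (negMap n i) = negMap n (τ i) := hτ i
  have hnegneg : τ (negMap n (τ i)) = negMap n (τ (τ i)) := hτ (τ i)
  have hinj := τ.injective
  have hninj := negMap_injective (n := n)
  by_cases hj : τ i = negMap n i
  · refine ⟨Equiv.swap i (negMap n i), Or.inl ⟨i, rfl⟩, ?_, fun k hk => ?_⟩
    · rw [hj, Equiv.swap_apply_right]
    · have := negMap_ne i
      have := negMap_negMap i
      apply Equiv.swap_apply_of_ne_of_ne <;> rintro rfl <;> grind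
  · refine ⟨_, Or.inr ⟨i, τ i, ?_, rfl⟩, ?_, fun k hk => ?_⟩
    · rw [Ne, absMap_eq_iff]
      tauto
    · rw [Equiv.Perm.mul_apply, Equiv.swap_apply_of_ne_of_ne _ (negMap_ne _).symm,
        Equiv.swap_apply_right]
      exact hj
    · have h1 : k ≠ i := by rintro rfl; exact hi hk
      have h2 : k ≠ τ i := by rintro rfl; exact hi (hinj hk)
      have h3 : k ≠ negMap n i := by
        rintro rfl; exact hi (hninj (hneg.symm.trans hk))
      have h4 : k ≠ negMap n (τ i) := by
        rintro rfl; exact hi (hinj (hninj (hnegneg.symm.trans hk)))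
      rw [Equiv.Perm.mul_apply, Equiv.swap_apply_of_ne_of_ne h3 h4,
        Equiv.swap_apply_of_ne_of_ne h1 h2]

lemma exists_Rn_word_le_support {τ : Equiv.Perm (Fin (2 * n))} (hτ : InWn n τ) :
    ∃ l : List (Equiv.Perm (Fin (2 * n))),
      (∀ ρ ∈ l, ρ ∈ Rn n) ∧ 2 * l.length ≤ τ.support.card ∧ l.prod = τ := by
  induction hm : τ.support.card using Nat.strong_induction_on generalizing τ with
  | _ m ih =>
  by_cases hone : τ = 1
  · exact ⟨[], by simp, by simp, by simp [hone]⟩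
  obtain ⟨i, hi⟩ : ∃ i, τ i ≠ i := by
    by_contra! h
    exact hone (Equiv.ext h)
  obtain ⟨ρ, hρ, hρi, hfix⟩ := exists_mem_Rn_apply_eq hτ hi
  have hW : InWn n (ρ * τ) := (inWn_of_mem_Rn hρ).mul hτ
  have hfixi : (ρ * τ) i = i := hρi
  have hfixni : (ρ * τ) (negMap n i) = negMap n i := by rw [hW, hfixi]
  have hni : τ (negMap n i) ≠ negMap n i := by
    rw [hτ]
    exact negMap_injective.ne hi
  have hsub : insert i (insert (negMap n i) (ρ * τ).support) ⊆ τ.support := by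
    intro k hk
    simp only [Finset.mem_insert, Equiv.Perm.mem_support] at hk ⊢
    rcases hk with rfl | rfl | hk
    · exact hi
    · exact hni
    · intro h
      exact hk (by rw [Equiv.Perm.mul_apply, h, hfix k h])
  have hcard := Finset.card_le_card hsub
  rw [Finset.card_insert_of_notMem, Finset.card_insert_of_notMem] at hcard
  · obtain ⟨l, hl, hlen, hprod⟩ := ih _ (by omega) hW rfl
    refine ⟨ρ :: l, by simpa [hρ] using hl, ?_, ?_⟩
    · simp only [List.length_cons]
      omega
    · rw [List.prod_cons, hprod, ← mul_assoc, mul_self_of_mem_Rn hρ, one_mul]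
  · simpa using hfixni
  · simpa [(negMap_ne i).symm] using hfixi

lemma lenB_le {τ : Equiv.Perm (Fin (2 * n))} (hτ : InWn n τ) : lenB n τ ≤ n := by
  obtain ⟨l, hl, hlen, hprod⟩ := exists_Rn_word_le_support hτ
  have h1 : lenB n τ ≤ l.length := Nat.sInf_le ⟨l, hl, rfl, hprod⟩
  have h2 := Finset.card_le_univ τ.support
  rw [Fintype.card_fin] at h2
  omega

lemma lenA_le_two_of_mem_Rn {ρ : Equiv.Perm (Fin (2 * n))} (hρ : ρ ∈ Rn n) :
    lenA (2 * n) ρ ≤ 2 := by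
  rcases hρ with ⟨i, rfl⟩ | ⟨i, j, -, rfl⟩
  · exact (lenA_swap_le_one _ _).trans one_le_two
  · exact (lenA_mul_le _ _).trans (add_le_add (lenA_swap_le_one _ _) (lenA_swap_le_one _ _))

lemma lenA_le_two_mul_lenB {τ : Equiv.Perm (Fin (2 * n))} (hτ : InWn n τ) :
    lenA (2 * n) τ ≤ 2 * lenB n τ := by
  have hne : {k | ∃ l : List (Equiv.Perm (Fin (2 * n))),
      (∀ ρ ∈ l, ρ ∈ Rn n) ∧ l.length = k ∧ l.prod = τ}.Nonempty := by
    obtain ⟨l, hl, -, hprod⟩ := exists_Rn_word_le_support hτ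
    exact ⟨l.length, l, hl, rfl, hprod⟩
  obtain ⟨l, hl, hlen, rfl⟩ := Nat.sInf_mem hne
  change l.length = lenB n l.prod at hlen
  rw [← hlen]
  clear hlen hne hτ
  induction l with
  | nil => simpa using lenA_le_length (N := 2 * n) (l := []) (by simp)
  | cons ρ t ih =>
    have h1 := lenA_le_two_of_mem_Rn (hl ρ (by simp))
    have h2 := ih fun σ hσ => hl σ (by simp [hσ])
    have h3 := lenA_mul_le ρ t.prod
    rw [List.prod_cons, List.length_cons]
    omega

end Hyperoctahedral

end NCPB

open NCPB in
/-- If `τ₁ ≤ τ₂ ≤ ω` with respect to the partial order coming from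
`(W_n, R_n)`, then `τ₁ ≤ τ₂` with respect to the partial order coming from
`(S_{±n}, T_{±n})`. -/
theorem leA_of_leB_le_omega (n : ℕ) (hn : 0 < n)
    (τ₁ τ₂ : Equiv.Perm (Fin (2*n))) (h1 : InWn n τ₁) (h2 : InWn n τ₂)
    (hle1 : leB n τ₁ τ₂) (hle2 : leB n τ₂ (omegaW n)) :
    leA (2*n) τ₁ τ₂ := by
  have hneA : NeZero (2 * n) := ⟨by omega⟩
  have h12 : InWn n (τ₁⁻¹ * τ₂) := h1.inv.mul h2
  have h2ω : InWn n (τ₂⁻¹ * omegaW n) := h2.inv.mul inWn_omegaW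
  have hω : 2 * n ≤ lenA (2 * n) (omegaW n) + 1 :=
    le_lenA_add_one (sameCycle_finRotate (by omega))
  have hωB := lenB_le (inWn_omegaW (n := n))
  have b1 := lenA_le_two_mul_lenB h1
  have b12 := lenA_le_two_mul_lenB h12
  have b2ω := lenA_le_two_mul_lenB h2ω
  have t12 := lenA_mul_le τ₁ (τ₁⁻¹ * τ₂)
  have t2ω := lenA_mul_le τ₂ (τ₂⁻¹ * omegaW n)
  have parity := even_lenA_mul_iff τ₁ (τ₁⁻¹ * τ₂)
  rw [mul_inv_cancel_left] at t12 t2ω parity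
  rw [Nat.even_iff, Nat.even_iff] at parity
  unfold leB at hle1 hle2
  unfold leA
  omega
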